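/- arXiv:2401.11290 — 8 statements merged into one kernel-verified Lean document; each statement's English description precedes it below -/
import Mathlib

section
/- Let V be a finite set of propositional variables, let L be a language of ω-words over the alphabet V → Bool, and let A be a trim nondeterministic Büchi automaton over the alphabet V → Bool with L(A) = L. Then for all sets X, Y ⊆ V: X is dependent on Y in L if and only if X is automata-dependent on Y in A. -/
/-- A nondeterministic Büchi automaton over alphabet `Sig` with states `Q`. -/
structure NBA (Sig : Type*) (Q : Type*) where
  δ : Q → Sig → Set Q
  q0 : Q
  F : Set Q

/-- `ρ` is a run of `A` on the ω-word `w`. -/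
def NBA.IsRun {Sig Q : Type*} (A : NBA Sig Q) (w : ℕ → Sig) (ρ : ℕ → Q) : Prop :=
  ρ 0 = A.q0 ∧ ∀ i, ρ (i + 1) ∈ A.δ (ρ i) (w i)

/-- `ρ` is an accepting run of `A` on `w`: it visits `A.F` infinitely often. -/
def NBA.IsAcceptingRun {Sig Q : Type*} (A : NBA Sig Q) (w : ℕ → Sig) (ρ : ℕ → Q) : Prop :=
  A.IsRun w ρ ∧ ∀ n, ∃ i ≥ n, ρ i ∈ A.F

/-- The language of an NBA: all ω-words admitting an accepting run. -/
def NBA.Language {Sig Q : Type*} (A : NBA Sig Q) : Set (ℕ → Sig) :=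
  { w | ∃ ρ, A.IsAcceptingRun w ρ }

/-- `r` is a finite run of `A` from `A.q0` to `s` labeled by the finite word `u`. -/
def NBA.IsFinRun {Sig Q : Type*} (A : NBA Sig Q) (u : List Sig) (r : ℕ → Q) (s : Q) : Prop :=
  r 0 = A.q0 ∧ r u.length = s ∧
    ∀ j (h : j < u.length), r (j + 1) ∈ A.δ (r j) (u.get ⟨j, h⟩)

/-- The pair `(s, s')` is compatible in `A`: some finite word labels both
a finite run from `A.q0` to `s` and a finite run from `A.q0` to `s'`. -/
def NBA.Compatible {Sig Q : Type*} (A : NBA Sig Q) (s s' : Q) : Prop :=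
  ∃ u : List Sig, (∃ r, A.IsFinRun u r s) ∧ (∃ r', A.IsFinRun u r' s')

/-- `A` is trim: every state and every transition lies on some accepting run. -/
def NBA.Trim {Sig Q : Type*} (A : NBA Sig Q) : Prop :=
  (∀ q : Q, ∃ w ρ, A.IsAcceptingRun w ρ ∧ ∃ i, ρ i = q) ∧
  (∀ q σ q', q' ∈ A.δ q σ →
    ∃ w ρ, A.IsAcceptingRun w ρ ∧ ∃ i, ρ i = q ∧ w i = σ ∧ ρ (i + 1) = q')

/-- `X` is dependent on `Y` in the language `L`. -/
def DependentOn {V : Type*} (L : Set (ℕ → V → Bool)) (X Y : Set V) : Prop :=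
  ∀ w ∈ L, ∀ w' ∈ L, ∀ i : ℕ,
    (∀ j < i, w j = w' j) → Set.EqOn (w i) (w' i) Y → Set.EqOn (w i) (w' i) X

/-- `X` is dependent in `L`, i.e. dependent on `V \ X` in `L`. -/
def DependentIn {V : Type*} (L : Set (ℕ → V → Bool)) (X : Set V) : Prop :=
  DependentOn L X Xᶜ

/-- `X` is automata-dependent on `Y` in `A`. -/
def NBA.AutDepOn {V Q : Type*} (A : NBA (V → Bool) Q) (X Y : Set V) : Prop :=
  ∀ s s', A.Compatible s s' → ∀ σ σ' : V → Bool,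
    Set.EqOn σ σ' Y → ¬ Set.EqOn σ σ' X →
    ¬ (A.δ s σ ≠ ∅ ∧ A.δ s' σ' ≠ ∅)

/-- In a trim automaton, a finite run followed by an enabled letter extends to an accepted word. -/
theorem NBA.Trim.exists_mem_language {Sig Q : Type*} {A : NBA Sig Q} (hA : A.Trim)
    {u : List Sig} {r : ℕ → Q} {s q : Q} {σ : Sig} (hr : A.IsFinRun u r s) (hq : q ∈ A.δ s σ) :
    ∃ w ∈ A.Language, (∀ j (h : j < u.length), w j = u.get ⟨j, h⟩) ∧ w u.length = σ := by
  obtain ⟨w, ρ, ⟨⟨-, hstep⟩, hacc⟩, i, hs, hσ, -⟩ := hA.2 s σ q hq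
  obtain ⟨hr0, hrs, hrstep⟩ := hr
  refine ⟨fun j => if h : j < u.length then u.get ⟨j, h⟩ else w (j - u.length + i),
    ⟨fun j => if j < u.length then r j else ρ (j - u.length + i), ⟨?_, fun j => ?_⟩, fun n => ?_⟩,
    fun j h => by simp [h], by simpa using hσ⟩
  · by_cases h : 0 < u.length
    · simpa [h] using hr0
    · have h0 : u.length = 0 := by omega
      rw [h0] at hrs
      simp [h0, hs, ← hrs, hr0]
  · rcases lt_trichotomy (j + 1) u.length with h | h | h
    · have hj : j < u.length := by omega
      simpa [h, hj] using hrstep j hj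
    · have hj : j < u.length := by omega
      have hmem := hrstep j hj
      rw [h, hrs, ← hs] at hmem
      simpa [h, hj] using hmem
    · have hj : ¬ j < u.length := by omega
      have hj' : ¬ j + 1 < u.length := by omega
      have hsub : j + 1 - u.length + i = j - u.length + i + 1 := by omega
      simpa only [hj, hj', dite_false, if_false, hsub] using hstep (j - u.length + i)
  · obtain ⟨m, hm, hF⟩ := hacc (n + i)
    refine ⟨m - i + u.length, by omega, ?_⟩
    have hsub : m - i + i = m := by omega
    simpa [hsub] using hF

/-- The first `i` steps of a run form a finite run. -/
theorem NBA.IsRun.isFinRun_ofFn {Sig Q : Type*} {A : NBA Sig Q} {w : ℕ → Sig} {ρ : ℕ → Q}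
    (h : A.IsRun w ρ) (i : ℕ) : A.IsFinRun (List.ofFn fun j : Fin i => w j) ρ (ρ i) :=
  ⟨h.1, by simp, fun j _ => by simpa using h.2 j⟩

/-- For a trim NBA `A` over `V → Bool` with `L(A) = L`, and all
`X Y ⊆ V`: `X` is dependent on `Y` in `L` iff `X` is automata-dependent on `Y` in `A`. -/
theorem dependent_iff_automataDependent {V Q : Type*} [Fintype V]
    (A : NBA (V → Bool) Q) (L : Set (ℕ → V → Bool))
    (hTrim : A.Trim) (hLang : A.Language = L) (X Y : Set V) :
    DependentOn L X Y ↔ A.AutDepOn X Y := by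
  subst hLang
  constructor
  · rintro h s s' ⟨u, ⟨r, hr⟩, r', hr'⟩ σ σ' hY hX ⟨hne, hne'⟩
    obtain ⟨q, hq⟩ := Set.nonempty_iff_ne_empty.mpr hne
    obtain ⟨q', hq'⟩ := Set.nonempty_iff_ne_empty.mpr hne'
    obtain ⟨w, hw, hwu, rfl⟩ := hTrim.exists_mem_language hr hq
    obtain ⟨w', hw', hwu', rfl⟩ := hTrim.exists_mem_language hr' hq'
    exact hX (h w hw w' hw' u.length (fun j hj => (hwu j hj).trans (hwu' j hj).symm) hY)
  · rintro h w ⟨ρ, hρ, -⟩ w' ⟨ρ', hρ', -⟩ i hpre hY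
    by_contra hX
    have hword : (List.ofFn fun j : Fin i => w j) = List.ofFn fun j : Fin i => w' j :=
      congrArg List.ofFn (funext fun j => hpre j j.2)
    exact h (ρ i) (ρ' i)
      ⟨_, ⟨ρ, hρ.isFinRun_ofFn i⟩, ρ', hword ▸ hρ'.isFinRun_ofFn i⟩ (w i) (w' i) hY hX
      ⟨Set.nonempty_iff_ne_empty.mp ⟨_, hρ.2 i⟩, Set.nonempty_iff_ne_empty.mp ⟨_, hρ'.2 i⟩⟩
end

section
/- Let A be a nondeterministic Büchi automaton over a product alphabet Σ_Y × Σ_X whose X-component is automata-dependent in A. Let the reachable subset states be the smallest family of subsets of Q containing {q0} and closed under U ↦ δ^X U σ_Y for every σ_Y ∈ Σ_Y. Then every reachable subset state U is pairwise compatible: for all q, q' ∈ U, the pair (q, q') is compatible in A. -/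
/-- The `X`-component is automata-dependent in `A` (over a product alphabet
`SY × SX`): for every compatible pair and a common `Y`-letter, the `X`-letters
admitting transitions coincide. -/
def NBA.XDep {SY SX Q : Type*} (A : NBA (SY × SX) Q) : Prop :=
  ∀ s s', A.Compatible s s' → ∀ (σY : SY) (σX σX' : SX),
    A.δ s (σY, σX) ≠ ∅ → A.δ s' (σY, σX') ≠ ∅ → σX = σX'

/-- The subset transition function `δ^X`. -/
def NBA.subsetTrans {SY SX Q : Type*} (A : NBA (SY × SX) Q) (U : Set Q) (σY : SY) :
    Set Q :=
  { q' | ∃ q ∈ U, ∃ σX : SX, q' ∈ A.δ q (σY, σX) }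

/-- The reachable subset states: the smallest family of subsets of `Q` containing
`{q0}` and closed under `U ↦ δ^X U σY` for every `σY`. -/
inductive NBA.ReachableSubset {SY SX Q : Type*} (A : NBA (SY × SX) Q) : Set Q → Prop
  | init : A.ReachableSubset {A.q0}
  | step (U : Set Q) (σY : SY) : A.ReachableSubset U → A.ReachableSubset (A.subsetTrans U σY)

/-- A finite run extends by a transition out of its last state. -/
theorem NBA.IsFinRun.exists_append_singleton {Sig Q : Type*} {A : NBA Sig Q} {u : List Sig}
    {r : ℕ → Q} {s t : Q} {σ : Sig} (h : A.IsFinRun u r s) (ht : t ∈ A.δ s σ) :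
    ∃ r', A.IsFinRun (u ++ [σ]) r' t := by
  obtain ⟨h0, hs, hstep⟩ := h
  refine ⟨fun n => if n ≤ u.length then r n else t, by simpa using h0, by simp, ?_⟩
  intro j hj
  have hj' : j ≤ u.length := by
    rw [List.length_append, List.length_singleton] at hj
    omega
  rcases hj'.lt_or_eq with hlt | rfl
  · simpa [hlt, hlt.le, Nat.succ_le_of_lt hlt, List.getElem_append_left] using hstep j hlt
  · simpa [hs] using ht

/-- Successors of a compatible pair under a common letter are compatible. -/
theorem NBA.Compatible.step {Sig Q : Type*} {A : NBA Sig Q} {s s' t t' : Q} {σ : Sig}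
    (h : A.Compatible s s') (ht : t ∈ A.δ s σ) (ht' : t' ∈ A.δ s' σ) : A.Compatible t t' := by
  obtain ⟨u, ⟨r, hr⟩, ⟨r', hr'⟩⟩ := h
  exact ⟨u ++ [σ], hr.exists_append_singleton ht, hr'.exists_append_singleton ht'⟩

/-- The initial state is compatible with itself. -/
theorem NBA.compatible_q0 {Sig Q : Type*} (A : NBA Sig Q) : A.Compatible A.q0 A.q0 := by
  have h : A.IsFinRun [] (fun _ => A.q0) A.q0 := ⟨rfl, rfl, by simp⟩
  exact ⟨[], ⟨_, h⟩, ⟨_, h⟩⟩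

/-- If the `X`-component is automata-dependent in `A`, then every
reachable subset state is pairwise compatible. -/
theorem reachableSubset_pairwise_compatible {SY SX Q : Type*}
    (A : NBA (SY × SX) Q) (hX : A.XDep) :
    ∀ U : Set Q, A.ReachableSubset U → ∀ q ∈ U, ∀ q' ∈ U, A.Compatible q q' := by
  intro U hU
  induction hU with
  | init =>
    rintro q rfl q' rfl
    exact A.compatible_q0
  | step U σY _ ih =>
    rintro q ⟨p, hp, σX, hq⟩ q' ⟨p', hp', σX', hq'⟩
    have hc := ih p hp p' hp'
    obtain rfl := hX p p' hc σY σX σX' (Set.nonempty_of_mem hq).ne_empty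
      (Set.nonempty_of_mem hq').ne_empty
    exact hc.step hq hq'
end

section
/- Let A be a nondeterministic Büchi automaton over a product alphabet Σ_Y × Σ_X whose X-component is automata-dependent in A, and let U ⊆ Q be a nonempty set of states that is pairwise compatible (every pair of states from U is compatible in A). Then for every σ_Y ∈ Σ_Y with δ^X U σ_Y ≠ ∅ there is a unique σ_X ∈ Σ_X such that δ q (σ_Y, σ_X) ≠ ∅ for some q ∈ U; moreover, for this σ_X, δ^X U σ_Y = { q' | ∃ q ∈ U, q' ∈ δ q (σ_Y, σ_X) }. -/
/-- If the `X`-component is automata-dependent in `A` and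
`U ≠ ∅` is pairwise compatible, then for every `σY` with `δ^X U σY ≠ ∅` there is a
unique `σX` admitting a transition from some `q ∈ U`, and for this `σX`,
`δ^X U σY = { q' | ∃ q ∈ U, q' ∈ δ q (σY, σX) }`. -/
theorem subsetTrans_unique_output {SY SX Q : Type*}
    (A : NBA (SY × SX) Q) (hX : A.XDep)
    (U : Set Q) (hne : U.Nonempty)
    (hcomp : ∀ q ∈ U, ∀ q' ∈ U, A.Compatible q q')
    (σY : SY) (h : A.subsetTrans U σY ≠ ∅) :
    (∃! σX : SX, ∃ q ∈ U, A.δ q (σY, σX) ≠ ∅) ∧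
    (∀ σX : SX, (∃ q ∈ U, A.δ q (σY, σX) ≠ ∅) →
      A.subsetTrans U σY = { q' | ∃ q ∈ U, q' ∈ A.δ q (σY, σX) }) := by
  have key : ∀ q ∈ U, ∀ q' ∈ U, ∀ σX σX' : SX,
      A.δ q (σY, σX) ≠ ∅ → A.δ q' (σY, σX') ≠ ∅ → σX = σX' :=
    fun q hq q' hq' σX σX' => hX q q' (hcomp q hq q' hq') σY σX σX'
  constructor
  · obtain ⟨_, q, hq, σX, hmem⟩ := Set.nonempty_iff_ne_empty.mpr h
    have hδ : A.δ q (σY, σX) ≠ ∅ := Set.nonempty_iff_ne_empty.mp ⟨_, hmem⟩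
    exact ⟨σX, ⟨q, hq, hδ⟩, fun σX' ⟨q', hq', hδ'⟩ => key q' hq' q hq σX' σX hδ' hδ⟩
  · rintro σX ⟨q, hq, hδ⟩
    ext p
    constructor
    · rintro ⟨q', hq', σX', hmem⟩
      obtain rfl := key q hq q' hq' σX σX' hδ (Set.nonempty_iff_ne_empty.mp ⟨p, hmem⟩)
      exact ⟨q', hq', hmem⟩
    · rintro ⟨q', hq', hmem⟩
      exact ⟨q', hq', σX, hmem⟩
end

section
/- Let V be partitioned into inputs I and outputs O, let L be a language of ω-words over V → Bool, and let X ⊆ O. If L is realizable with inputs I and outputs O, then the projection L↓(V \ X) is realizable with inputs I and outputs O \ X. -/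
/-- Restriction of a letter `σ : V → Bool` to a subset `Z ⊆ V`. -/
def Restrict {V : Type*} (σ : V → Bool) (Z : Set V) : ↥Z → Bool :=
  fun z => σ z.val

/-- The ω-word `w` is consistent with the strategy `f` (inputs `I`, outputs `O`). -/
def ConsistentWith {V : Type*} (I O : Set V)
    (f : List (↥I → Bool) → (↥O → Bool)) (w : ℕ → V → Bool) : Prop :=
  ∀ i : ℕ, Restrict (w i) O = f ((List.range (i + 1)).map fun j => Restrict (w j) I)

/-- The strategy `f` realizes `L`: every word consistent with `f` lies in `L`. -/
def Realizes {V : Type*} (L : Set (ℕ → V → Bool)) (I O : Set V)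
    (f : List (↥I → Bool) → (↥O → Bool)) : Prop :=
  ∀ w : ℕ → V → Bool, ConsistentWith I O f w → w ∈ L

/-- `L` is realizable with inputs `I` and outputs `O`. -/
def Realizable {V : Type*} (L : Set (ℕ → V → Bool)) (I O : Set V) : Prop :=
  ∃ f : List (↥I → Bool) → (↥O → Bool), Realizes L I O f

/-- The projection of a language `L` onto a subset `Z ⊆ V`. -/
def ProjLang {V : Type*} (L : Set (ℕ → V → Bool)) (Z : Set V) :
    Set (ℕ → ↥Z → Bool) :=
  { v | ∃ w ∈ L, ∀ i : ℕ, v i = Restrict (w i) Z }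

/-- For `V` partitioned into inputs `I` and outputs `O` and
`X ⊆ O`: if `L` is realizable with inputs `I` and outputs `O`, then the projection
`L↓(V \ X)` is realizable with inputs `I` and outputs `O \ X`. -/
theorem proj_realizable_of_realizable {V : Type*} [Fintype V]
    (I O : Set V) (hdisj : I ∩ O = ∅) (hunion : I ∪ O = Set.univ)
    (L : Set (ℕ → V → Bool)) (X : Set V) (hXO : X ⊆ O)
    (hreal : Realizable L I O) :
    Realizable (ProjLang L Xᶜ)
      { a : ↥Xᶜ | a.val ∈ I } { a : ↥Xᶜ | a.val ∈ O \ X } := by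
  classical
  obtain ⟨f, hf⟩ := hreal
  have hIX : ∀ a ∈ I, a ∉ X := fun a ha hx => by
    have h : a ∈ I ∩ O := ⟨ha, hXO hx⟩
    simp [hdisj] at h
  let lift : (↥{ a : ↥Xᶜ | a.val ∈ I } → Bool) → (↥I → Bool) :=
    fun u a => u ⟨⟨a.val, hIX a.val a.2⟩, a.2⟩
  refine ⟨fun l a => f (l.map lift) ⟨a.val.val, a.2.1⟩, fun v hv => ?_⟩
  let w : ℕ → V → Bool := fun i a =>
    if h : a ∈ X then
      f ((List.range (i + 1)).map fun j => lift (Restrict (v j) _)) ⟨a, hXO h⟩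
    else v i ⟨a, h⟩
  have hin : ∀ j, Restrict (w j) I = lift (Restrict (v j) _) := fun j => by
    funext a
    simp [w, lift, Restrict, hIX a.val a.2]
  refine ⟨w, hf w fun i => ?_, fun i => ?_⟩
  · simp only [hin]
    funext a
    by_cases h : a.val ∈ X
    · simp [Restrict, w, h]
    · have hva := congrFun (hv i) ⟨⟨a.val, h⟩, a.2, h⟩
      simp only [List.map_map, Function.comp_def] at hva
      rw [← hva]
      simp [Restrict, w, h]
  · funext a
    have h : a.val ∉ X := a.2
    simp [Restrict, w, h]
end

section
/- Let V be partitioned into inputs I and outputs O and let L be a language of ω-words over V → Bool such that O is dependent in L (i.e., dependent on I = V \ O). If strategies f and g both realize L, then f u = g u for every nonempty list u of input letters; that is, the winning strategy for L is unique. -/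
open Classical in
/-- The ω-word produced by the strategy `f` against the input sequence `x`. -/
noncomputable def outcome {V : Type*} (I O : Set V)
    (f : List (↥I → Bool) → (↥O → Bool)) (x : ℕ → ↥I → Bool) : ℕ → V → Bool :=
  fun i v =>
    if h : v ∈ O then f ((List.range (i + 1)).map x) ⟨v, h⟩
    else if h : v ∈ I then x i ⟨v, h⟩ else false

theorem restrict_outcome_inputs {V : Type*} {I O : Set V} (hdisj : Disjoint I O)
    (f : List (↥I → Bool) → (↥O → Bool)) (x : ℕ → ↥I → Bool) (i : ℕ) :
    Restrict (outcome I O f x i) I = x i := by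
  funext v
  simp [Restrict, outcome, hdisj.notMem_of_mem_left v.2]

theorem restrict_outcome_outputs {V : Type*} (I O : Set V)
    (f : List (↥I → Bool) → (↥O → Bool)) (x : ℕ → ↥I → Bool) (i : ℕ) :
    Restrict (outcome I O f x i) O = f ((List.range (i + 1)).map x) := by
  funext v
  simp [Restrict, outcome]

theorem consistentWith_outcome {V : Type*} {I O : Set V} (hdisj : Disjoint I O)
    (f : List (↥I → Bool) → (↥O → Bool)) (x : ℕ → ↥I → Bool) :
    ConsistentWith I O f (outcome I O f x) := by
  intro i
  simp only [restrict_outcome_inputs hdisj, restrict_outcome_outputs]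

theorem outcome_eq_of_dependentIn {V : Type*} {I O : Set V} (hdisj : Disjoint I O)
    {L : Set (ℕ → V → Bool)} (hdep : DependentIn L O)
    {f g : List (↥I → Bool) → (↥O → Bool)}
    (hf : Realizes L I O f) (hg : Realizes L I O g) (x : ℕ → ↥I → Bool) :
    outcome I O f x = outcome I O g x := by
  funext i
  induction i using Nat.strong_induction_on with
  | _ i ih =>
    have hcompl : Set.EqOn (outcome I O f x i) (outcome I O g x i) Oᶜ := by
      intro v hv
      simp [outcome, (Set.mem_compl_iff O v).1 hv]
    have hO := hdep _ (hf _ (consistentWith_outcome hdisj f x))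
      _ (hg _ (consistentWith_outcome hdisj g x)) i ih hcompl
    funext v
    by_cases hv : v ∈ O
    · exact hO hv
    · exact hcompl hv

/-- If `O` is dependent in `L` (on `I = V \ O`) and both `f` and
`g` realize `L`, then `f` and `g` agree on every nonempty list of input letters:
the winning strategy is unique. -/
theorem winning_strategy_unique {V : Type*} [Fintype V]
    (I O : Set V) (hdisj : I ∩ O = ∅) (hunion : I ∪ O = Set.univ)
    (L : Set (ℕ → V → Bool)) (hdep : DependentIn L O)
    (f g : List (↥I → Bool) → (↥O → Bool))
    (hf : Realizes L I O f) (hg : Realizes L I O g) :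
    ∀ u : List (↥I → Bool), u ≠ [] → f u = g u := by
  intro u hu
  have hd : Disjoint I O := Set.disjoint_iff_inter_eq_empty.2 hdisj
  let x : ℕ → ↥I → Bool := fun i => u.getD i fun _ => false
  have hlen : u.length - 1 + 1 = u.length :=
    Nat.sub_add_cancel (List.length_pos_iff.2 hu)
  have hx : (List.range (u.length - 1 + 1)).map x = u := by
    rw [hlen]
    apply List.ext_getElem
    · simp
    · intro i _ hi
      simp [x, hi]
  have h := congrArg (fun w => Restrict (w (u.length - 1)) O)
    (outcome_eq_of_dependentIn hd hdep hf hg x)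
  simpa only [restrict_outcome_outputs, hx] using h
end

section
/- Let V be partitioned into inputs I and outputs O and let L be a language of ω-words over V → Bool such that O is dependent in L and L is realizable with inputs I and outputs O. Then for every input word x : ℕ → (I → Bool) there is exactly one w ∈ L with (w i)|_I = x i for all i ∈ ℕ. -/
/-- Two words of a language in which `O` is dependent coincide as soon as they agree on a set
`I` that covers the complement of `O`. -/
theorem DependentIn.eq_of_restrict_eq {V : Type*} {L : Set (ℕ → V → Bool)} {I O : Set V}
    (hdep : DependentIn L O) (hunion : I ∪ O = Set.univ) {w w' : ℕ → V → Bool}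
    (hw : w ∈ L) (hw' : w' ∈ L) (h : ∀ i, Restrict (w i) I = Restrict (w' i) I) : w = w' := by
  have hI : ∀ i, Set.EqOn (w i) (w' i) I := fun i v hv => congrFun (h i) ⟨v, hv⟩
  have hcover : ∀ v, v ∈ I ∨ v ∈ O := Set.eq_univ_iff_forall.mp hunion
  funext i
  induction i using Nat.strong_induction_on with
  | _ i ih =>
    have hO := hdep w hw w' hw' i ih fun v hv => hI i ((hcover v).resolve_right hv)
    funext v
    exact (hcover v).elim (fun hv => hI i hv) fun hv => hO hv

/-- Every input word is the input part of some word consistent with a given strategy. -/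
theorem exists_consistentWith {V : Type*} {I O : Set V} (hdisj : I ∩ O = ∅)
    (f : List (↥I → Bool) → (↥O → Bool)) (x : ℕ → (↥I → Bool)) :
    ∃ w : ℕ → V → Bool, ConsistentWith I O f w ∧ ∀ i, Restrict (w i) I = x i := by
  classical
  let w : ℕ → V → Bool := fun i v =>
    if hv : v ∈ I then x i ⟨v, hv⟩
    else if hv : v ∈ O then f ((List.range (i + 1)).map x) ⟨v, hv⟩ else false
  have hwI : ∀ i, Restrict (w i) I = x i := fun i => by
    funext v
    simp [w, Restrict]
  refine ⟨w, fun i => ?_, hwI⟩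
  simp only [hwI]
  funext v
  have hv : v.val ∉ I := fun hv => (Set.eq_empty_iff_forall_notMem.mp hdisj v.val) ⟨hv, v.2⟩
  simp [w, Restrict, hv]

/-- If `O` is dependent in `L` and `L` is realizable with inputs
`I` and outputs `O`, then every input word extends to exactly one word of `L`. -/
theorem unique_word_for_each_input {V : Type*} [Fintype V]
    (I O : Set V) (hdisj : I ∩ O = ∅) (hunion : I ∪ O = Set.univ)
    (L : Set (ℕ → V → Bool)) (hdep : DependentIn L O)
    (hreal : Realizable L I O) :
    ∀ x : ℕ → (↥I → Bool),
      ∃! w : ℕ → V → Bool, w ∈ L ∧ ∀ i : ℕ, Restrict (w i) I = x i := by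
  intro x
  obtain ⟨f, hf⟩ := hreal
  obtain ⟨w, hw, hwx⟩ := exists_consistentWith hdisj f x
  refine ⟨w, ⟨hf w hw, hwx⟩, fun w' hw' => ?_⟩
  exact hdep.eq_of_restrict_eq hunion hw'.1 (hf w hw) fun i => (hw'.2 i).trans (hwx i).symm
end

section
/- Let L be a language of ω-words over V → Bool, let X ⊆ V be dependent in L (i.e., dependent on V \ X in L), and let z ∈ V \ X be such that {z} is dependent on V \ (X ∪ {z}) in L. Then X ∪ {z} is dependent on V \ (X ∪ {z}) in L, i.e., X ∪ {z} is dependent in L. -/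
/-- If `X` is dependent in `L`, `z ∉ X`, and `{z}` is dependent
on `V \ (X ∪ {z})` in `L`, then `X ∪ {z}` is dependent in `L`. -/
theorem dependentIn_insert {V : Type*} [Fintype V]
    (L : Set (ℕ → V → Bool)) (X : Set V) (z : V) (hz : z ∉ X)
    (hdep : DependentIn L X)
    (hzdep : DependentOn L {z} (X ∪ {z})ᶜ) :
    DependentIn L (X ∪ {z}) := by
  intro w hw w' hw' i hpre heq
  have hz_eq := hzdep w hw w' hw' i hpre heq
  refine Set.EqOn.union (hdep w hw w' hw' i hpre fun v hv => ?_) hz_eq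
  by_cases hvz : v ∈ ({z} : Set V)
  · exact hz_eq hvz
  · exact heq fun hmem => hmem.elim hv hvz
end

section
/- Let V be partitioned into inputs I and outputs O, let L be a language of ω-words over V → Bool, and let z_1, …, z_n be an enumeration without repetition of O. Define X_0 = ∅ and, for 1 ≤ k ≤ n, X_k = X_{k-1} ∪ {z_k} if {z_k} is dependent on V \ (X_{k-1} ∪ {z_k}) in L, and X_k = X_{k-1} otherwise. Then X_n is dependent in L and is a maximal dependent set: there is no X' with X_n ⊊ X' ⊆ O such that X' is dependent in L. -/
theorem DependentOn.mono {V : Type*} {L : Set (ℕ → V → Bool)} {X X' Y Y' : Set V}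
    (h : DependentOn L X' Y) (hX : X ⊆ X') (hY : Y ⊆ Y') : DependentOn L X Y' :=
  fun w hw w' hw' i hi he => (h w hw w' hw' i hi (he.mono hY)).mono hX

theorem DependentIn.union_singleton {V : Type*} {L : Set (ℕ → V → Bool)} {X : Set V} {v : V}
    (hX : DependentIn L X) (hv : DependentOn L {v} (X ∪ {v})ᶜ) : DependentIn L (X ∪ {v}) := by
  intro w hw w' hw' i hi he
  have hv' := hv w hw w' hw' i hi he
  refine (hX w hw w' hw' i hi fun u hu => ?_).union hv'
  by_cases huv : u ∈ ({v} : Set V)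
  · exact hv' huv
  · exact he fun h => h.elim hu huv

/-- Iterating over an enumeration `z 0, …, z (n-1)` (without
repetition) of the outputs `O`, greedily adding `z k` whenever `{z k}` is
dependent on `V \ (X_{k} ∪ {z k})` in `L`, yields a set `X n` that is dependent
in `L` and is a maximal dependent subset of `O`. -/
theorem findDependent_maximal {V : Type*} [Fintype V]
    (I O : Set V) (hdisj : I ∩ O = ∅) (hunion : I ∪ O = Set.univ)
    (L : Set (ℕ → V → Bool))
    (n : ℕ) (z : Fin n → V) (hinj : Function.Injective z)
    (hrange : Set.range z = O)
    (X : ℕ → Set V) (hX0 : X 0 = ∅)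
    (hstep : ∀ k (h : k < n),
      (DependentOn L {z ⟨k, h⟩} (X k ∪ {z ⟨k, h⟩})ᶜ →
        X (k + 1) = X k ∪ {z ⟨k, h⟩}) ∧
      (¬ DependentOn L {z ⟨k, h⟩} (X k ∪ {z ⟨k, h⟩})ᶜ →
        X (k + 1) = X k)) :
    DependentIn L (X n) ∧
      ¬ ∃ X' : Set V, X n ⊂ X' ∧ X' ⊆ O ∧ DependentIn L X' := by
  have hsub : ∀ k < n, X k ⊆ X (k + 1) := fun k hk => by
    by_cases h : DependentOn L {z ⟨k, hk⟩} (X k ∪ {z ⟨k, hk⟩})ᶜ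
    · rw [(hstep k hk).1 h]
      exact Set.subset_union_left
    · rw [(hstep k hk).2 h]
  have hmono : ∀ m ≤ n, ∀ k ≤ m, X k ⊆ X m := fun m hm k hk => by
    induction m, hk using Nat.le_induction with
    | base => exact subset_rfl
    | succ m _ ih => exact (ih (by omega)).trans (hsub m hm)
  have hdep : ∀ k ≤ n, DependentIn L (X k) := fun k hk => by
    induction k with
    | zero =>
      rw [hX0]
      exact fun _ _ _ _ _ _ _ => Set.eqOn_empty _ _
    | succ k ih =>
      by_cases h : DependentOn L {z ⟨k, hk⟩} (X k ∪ {z ⟨k, hk⟩})ᶜ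
      · rw [(hstep k hk).1 h]
        exact (ih (by omega)).union_singleton h
      · rw [(hstep k hk).2 h]
        exact ih (by omega)
  refine ⟨hdep n le_rfl, ?_⟩
  rintro ⟨X', hss, hX'O, hX'⟩
  obtain ⟨v, hvX', hvX⟩ := Set.exists_of_ssubset hss
  have hvO := hX'O hvX'
  rw [← hrange] at hvO
  obtain ⟨⟨k, hk⟩, rfl⟩ := hvO
  have hz : DependentOn L {z ⟨k, hk⟩} (X k ∪ {z ⟨k, hk⟩})ᶜ :=
    DependentOn.mono hX' (Set.singleton_subset_iff.2 hvX') (Set.compl_subset_compl.2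
      (Set.union_subset ((hmono n le_rfl k hk.le).trans hss.subset)
        (Set.singleton_subset_iff.2 hvX')))
  apply hvX
  apply hmono n le_rfl (k + 1) hk
  rw [(hstep k hk).1 hz]
  exact Or.inr rfl
end
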